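/- arXiv:2211.09187 — 5 statements merged into one kernel-verified Lean document; each statement's English description precedes it below -/
import Mathlib

section
/- Let q be a positive integer and let Λ be a set of nonnegative rational numbers which satisfies the descending chain condition and all of whose accumulation points (computed in ℝ) are rational. Define Σ_q := { (b⁺ − b)/m : b ∈ Λ, m a positive integer, b⁺ a rational number with q·b⁺ a positive integer and b⁺ ≤ 1, and (b⁺ − b)/m ≥ 0 }. Then Σ_q satisfies the ascending chain condition, i.e. Σ_q contains no infinite strictly increasing sequence. -/
/-- **Lemma 2.20 (first conclusion).**
Let `q` be a positive integer and `Λ` a set of nonnegative rational numbers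
satisfying the descending chain condition (no infinite strictly decreasing
sequence) and all of whose accumulation points in `ℝ` are rational.  Then the
set `Σ_q := {(b⁺ - b)/m ≥ 0 ∣ q·b⁺ ∈ ℤ_{>0}, b⁺ ≤ 1, m ∈ ℤ_{>0}, b ∈ Λ}`
satisfies the ascending chain condition (no infinite strictly increasing
sequence). -/
theorem dcc_set_quotient_acc (q : ℕ) (hq : 0 < q) (Λ : Set ℚ)
    (hnonneg : ∀ b ∈ Λ, 0 ≤ b)
    (hDCC : ¬ ∃ f : ℕ → ℚ, (∀ n, f n ∈ Λ) ∧ StrictAnti f)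
    (hacc : ∀ a : ℝ, AccPt a (Filter.principal {x : ℝ | ∃ b ∈ Λ, (b : ℝ) = x}) →
      ∃ r : ℚ, a = (r : ℝ)) :
    ¬ ∃ f : ℕ → ℚ,
      (∀ n, f n ∈ {x : ℚ | ∃ b ∈ Λ, ∃ m : ℕ, 0 < m ∧ ∃ bp : ℚ,
        (∃ k : ℤ, 0 < k ∧ (q : ℚ) * bp = (k : ℚ)) ∧ bp ≤ 1 ∧ 0 ≤ x ∧
        x = (bp - b) / (m : ℚ)}) ∧
      StrictMono f := by
  rintro ⟨f, hf, hmono⟩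
  simp only [Set.mem_ofPred_eq] at hf
  choose b hb m hm bp hk hbp hf0 hfe using hf
  choose k hk0 hk using hk
  have hqQ : (0 : ℚ) < q := by exact_mod_cast hq
  have h1 : 0 < f 1 := lt_of_le_of_lt (hf0 0) (hmono Nat.zero_lt_one)
  obtain ⟨M, hM⟩ := exists_nat_ge (1 / f 1)
  have hmM : ∀ n, m (n + 1) < M + 1 := by
    intro n
    have hmp : (0 : ℚ) < m (n + 1) := by exact_mod_cast hm (n + 1)
    have h2 : f 1 ≤ f (n + 1) := hmono.monotone (by omega)
    have h3 : f (n + 1) * m (n + 1) = bp (n + 1) - b (n + 1) := by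
      rw [hfe (n + 1)]; field_simp
    have h4 : f 1 * m (n + 1) ≤ 1 := by
      have := mul_le_mul_of_nonneg_right h2 hmp.le
      linarith [hbp (n + 1), hnonneg _ (hb (n + 1))]
    have h5 : (m (n + 1) : ℚ) ≤ 1 / f 1 := by
      rw [le_div_iff₀ h1]; linarith
    have h6 : (m (n + 1) : ℚ) ≤ M := h5.trans hM
    have h7 : m (n + 1) ≤ M := by exact_mod_cast h6
    omega
  have hkq : ∀ n, (k n).toNat < q + 1 := by
    intro n
    have h2 : (k n : ℚ) ≤ q := by
      rw [← hk n]
      nlinarith [hbp n]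
    have h3 : k n ≤ q := by exact_mod_cast h2
    omega
  let g : ℕ → Fin (M + 1) × Fin (q + 1) :=
    fun n => (⟨m (n + 1), hmM n⟩, ⟨(k (n + 1)).toNat, hkq (n + 1)⟩)
  obtain ⟨y, hy⟩ := Finite.exists_infinite_fiber g
  classical
  let e := Nat.orderEmbeddingOfSet (g ⁻¹' {y})
  have he : ∀ n, g (e n) = y := by
    intro n
    have h : e n ∈ Set.range e := Set.mem_range_self n
    rw [Nat.orderEmbeddingOfSet_range (g ⁻¹' {y})] at h
    exact h
  apply hDCC
  refine ⟨fun n => b (e n + 1), fun n => hb _, ?_⟩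
  intro i j hij
  have hg : g (e i) = g (e j) := (he i).trans (he j).symm
  simp only [g, Prod.mk.injEq, Fin.mk.injEq] at hg
  obtain ⟨hg1, hg2⟩ := hg
  have hk' : k (e i + 1) = k (e j + 1) := by
    have := hk0 (e i + 1)
    have := hk0 (e j + 1)
    omega
  have hbp' : bp (e i + 1) = bp (e j + 1) := by
    apply mul_left_cancel₀ hqQ.ne'
    rw [hk, hk, hk']
  have hlt : f (e i + 1) < f (e j + 1) := by
    apply hmono
    have := e.strictMono hij
    omega
  have hmp : (0 : ℚ) < m (e j + 1) := by exact_mod_cast hm (e j + 1)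
  rw [hfe (e i + 1), hfe (e j + 1), hg1, hbp', div_lt_div_iff_of_pos_right hmp] at hlt
  show b (e j + 1) < b (e i + 1)
  linarith
end

section
/- Let q be a positive integer and let Λ be a set of nonnegative rational numbers which satisfies the descending chain condition and all of whose accumulation points (computed in ℝ) are rational. Define Σ_q := { (b⁺ − b)/m : b ∈ Λ, m a positive integer, b⁺ a rational number with q·b⁺ a positive integer and b⁺ ≤ 1, and (b⁺ − b)/m ≥ 0 }. Then every accumulation point of Σ_q, computed in ℝ, is a rational number. -/
/-- **Lemma 2.20 (second conclusion).**
Let `q` be a positive integer and `Λ` a set of nonnegative rational numbers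
satisfying the descending chain condition and all of whose accumulation points
in `ℝ` are rational.  Then every accumulation point in `ℝ` of the set
`Σ_q := {(b⁺ - b)/m ≥ 0 ∣ q·b⁺ ∈ ℤ_{>0}, b⁺ ≤ 1, m ∈ ℤ_{>0}, b ∈ Λ}` is
rational. -/
theorem dcc_set_quotient_rational_accumulation (q : ℕ) (hq : 0 < q) (Λ : Set ℚ)
    (hnonneg : ∀ b ∈ Λ, 0 ≤ b)
    (hDCC : ¬ ∃ f : ℕ → ℚ, (∀ n, f n ∈ Λ) ∧ StrictAnti f)
    (hacc : ∀ a : ℝ, AccPt a (Filter.principal {x : ℝ | ∃ b ∈ Λ, (b : ℝ) = x}) →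
      ∃ r : ℚ, a = (r : ℝ)) :
    ∀ a : ℝ, AccPt a (Filter.principal {x : ℝ | ∃ s ∈ {x : ℚ | ∃ b ∈ Λ, ∃ m : ℕ, 0 < m ∧
        ∃ bp : ℚ, (∃ k : ℤ, 0 < k ∧ (q : ℚ) * bp = (k : ℚ)) ∧ bp ≤ 1 ∧ 0 ≤ x ∧
        x = (bp - b) / (m : ℚ)}, (s : ℝ) = x}) →
      ∃ r : ℚ, a = (r : ℝ) := by
  intro a ha
  by_contra hirr
  have key : ∀ k m : ℕ, 0 < m → ∀ᶠ y in nhds a,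
      ¬ (y ≠ a ∧ ∃ b ∈ Λ, (b : ℝ) = (k : ℝ) / q - m * y) := by
    intro k m hm
    have hm' : (m : ℝ) ≠ 0 := by positivity
    have h1 : ¬ AccPt ((k : ℝ) / q - m * a)
        (Filter.principal {x : ℝ | ∃ b ∈ Λ, (b : ℝ) = x}) := by
      intro h
      obtain ⟨r, hr⟩ := hacc _ h
      apply hirr
      refine ⟨((k : ℚ) / q - r) / m, ?_⟩
      push_cast
      rw [← hr]
      field_simp
      ring
    rw [accPt_iff_frequently, Filter.not_frequently] at h1
    have hc : Filter.Tendsto (fun y : ℝ => (k : ℝ) / q - m * y) (nhds a)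
        (nhds ((k : ℝ) / q - m * a)) := by
      apply Continuous.tendsto
      fun_prop
    filter_upwards [hc.eventually h1] with y hy
    rintro ⟨hya, hb⟩
    apply hy
    refine ⟨?_, hb⟩
    intro h
    apply hya
    have : (m : ℝ) * y = m * a := by linarith
    exact mul_left_cancel₀ hm' this
  rw [accPt_iff_frequently] at ha
  have hq' : (0 : ℚ) < q := by exact_mod_cast hq
  have ha0 : a ≠ 0 := by
    intro h
    exact hirr ⟨0, by simp [h]⟩
  rcases lt_or_gt_of_ne ha0 with hneg | hpos
  · obtain ⟨y, ⟨_, s, ⟨b, hb, m, hm, bp, _, _, h0, _⟩, hs⟩, hy⟩ :=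
      (ha.and_eventually (eventually_lt_nhds hneg)).exists
    have : (0 : ℝ) ≤ s := by exact_mod_cast h0
    linarith
  · obtain ⟨M, hM⟩ := exists_nat_gt (2 / a)
    have hall : ∀ᶠ y in nhds a, ∀ p ∈ Finset.range (q + 1) ×ˢ Finset.Icc 1 M,
        ¬ (y ≠ a ∧ ∃ b ∈ Λ, (b : ℝ) = (p.1 : ℝ) / q - p.2 * y) := by
      rw [Filter.eventually_all_finset]
      intro p hp
      simp only [Finset.mem_product, Finset.mem_Icc] at hp
      exact key p.1 p.2 (by omega)
    obtain ⟨y, ⟨hya, s, ⟨b, hb, m, hm, bp, ⟨k, hk, hkq⟩, hbp, h0, hx⟩, hs⟩, hy, hall⟩ :=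
      (ha.and_eventually ((eventually_gt_nhds (half_lt_self hpos)).and hall)).exists
    have hm' : (0 : ℚ) < m := by exact_mod_cast hm
    have hmr : (0 : ℝ) < m := by exact_mod_cast hm
    have hb0 := hnonneg b hb
    lift k to ℕ using hk.le
    have hsm : s * m = bp - b := by
      rw [hx]
      field_simp
    have hle : s * m ≤ 1 := by linarith
    have hle' : y * m ≤ 1 := by
      rw [← hs]
      exact_mod_cast hle
    have hkq2 : k ≤ q := by
      have : (k : ℚ) ≤ q := by
        have h2 : (q : ℚ) * bp ≤ q * 1 := mul_le_mul_of_nonneg_left hbp hq'.le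
        push_cast at hkq
        linarith
      exact_mod_cast this
    have hmM : m ≤ M := by
      have : (m : ℝ) < M := by
        refine lt_of_le_of_lt ?_ hM
        rw [le_div_iff₀ hpos]
        nlinarith
      exact_mod_cast this.le
    apply hall (k, m)
    · simp only [Finset.mem_product, Finset.mem_range, Finset.mem_Icc]
      omega
    · refine ⟨hya, b, hb, ?_⟩
      have : b = (k : ℚ) / q - m * s := by
        have : bp = (k : ℚ) / q := by
          rw [eq_div_iff hq'.ne']
          push_cast at hkq
          linarith
        rw [← this]
        linarith
      rw [← hs, this]
      push_cast
      rfl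
end

section
/- Let Λ be a set of real numbers contained in [0,1]. Then D(D(Λ)) = D(Λ); that is, the derived set D(Λ) is itself a derived set. -/
/-- The derived set `D(Λ)` of a set `Λ ⊆ [0,1]`: all numbers
`a = (m - 1 + λ₁ + ⋯ + λₙ)/m ∈ [0,1]` with `n ≥ 0`, `m ≥ 1` and
`λ₁, …, λₙ ∈ Λ ∪ {0,1}`. -/
def derivedCoeffSet (Λ : Set ℝ) : Set ℝ :=
  {a | a ∈ Set.Icc (0 : ℝ) 1 ∧ ∃ (n : ℕ) (m : ℕ), 0 < m ∧ ∃ f : Fin n → ℝ,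
    (∀ i, f i ∈ Λ ∪ {0, 1}) ∧ a = ((m : ℝ) - 1 + ∑ i, f i) / (m : ℝ)}

lemma derivedCoeffSet_mem_iff (Λ : Set ℝ) (a : ℝ) :
    a ∈ derivedCoeffSet Λ ↔ a ∈ Set.Icc (0 : ℝ) 1 ∧ ∃ m : ℕ, 0 < m ∧
      ∃ s ∈ AddSubmonoid.closure (Λ ∪ {0, 1}), a = ((m : ℝ) - 1 + s) / (m : ℝ) := by
  constructor
  · rintro ⟨h, n, m, hm, f, hf, e⟩
    exact ⟨h, m, hm, _, AddSubmonoid.sum_mem _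
      (fun i _ => AddSubmonoid.subset_closure (hf i)), e⟩
  · rintro ⟨h, m, hm, s, hs, e⟩
    obtain ⟨l, hl, rfl⟩ := AddSubmonoid.exists_list_of_mem_closure hs
    refine ⟨h, l.length, m, hm, l.get, fun i => hl _ (List.get_mem l i), ?_⟩
    rw [e, ← List.sum_ofFn, List.ofFn_get]

lemma derivedCoeffSet_closure_nonneg (Λ : Set ℝ) (hΛ : Λ ⊆ Set.Icc 0 1) (s : ℝ)
    (hs : s ∈ AddSubmonoid.closure (Λ ∪ {0, 1})) : 0 ≤ s := by
  induction hs using AddSubmonoid.closure_induction with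
  | mem x hx =>
    rcases hx with h | rfl | rfl
    · exact (hΛ h).1
    · norm_num
    · norm_num
  | zero => norm_num
  | add x y _ _ hx hy => linarith

lemma derivedCoeffSet_closure (Λ : Set ℝ) (hΛ : Λ ⊆ Set.Icc 0 1) (t : ℝ)
    (ht : t ∈ AddSubmonoid.closure (derivedCoeffSet Λ ∪ {0, 1})) :
    0 ≤ t ∧ (1 ≤ t ∨ ∃ k : ℕ, 0 < k ∧
      ∃ s ∈ AddSubmonoid.closure (Λ ∪ {0, 1}), t = ((k : ℝ) - 1 + s) / (k : ℝ)) := by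
  induction ht using AddSubmonoid.closure_induction with
  | mem x hx =>
    rcases hx with h | rfl | rfl
    · have h' := (derivedCoeffSet_mem_iff Λ x).1 h
      exact ⟨h'.1.1, Or.inr h'.2⟩
    · exact ⟨le_rfl, Or.inr ⟨1, one_pos, 0, zero_mem _, by norm_num⟩⟩
    · exact ⟨zero_le_one, Or.inl le_rfl⟩
  | zero => exact ⟨le_rfl, Or.inr ⟨1, one_pos, 0, zero_mem _, by norm_num⟩⟩
  | add x y _ _ hx hy =>
    obtain ⟨hx0, hx⟩ := hx
    obtain ⟨hy0, hy⟩ := hy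
    refine ⟨by linarith, ?_⟩
    rcases hx with hx | ⟨k, hk, s, hs, ex⟩
    · left; linarith
    rcases hy with hy | ⟨l, hl, r, hr, ey⟩
    · left; linarith
    have hs0 := derivedCoeffSet_closure_nonneg Λ hΛ s hs
    have hr0 := derivedCoeffSet_closure_nonneg Λ hΛ r hr
    have hk' : (0 : ℝ) < k := by exact_mod_cast hk
    have hl' : (0 : ℝ) < l := by exact_mod_cast hl
    by_cases h1 : k = 1
    · right
      refine ⟨l, hl, r + l • s, add_mem hr (AddSubmonoid.nsmul_mem _ hs _), ?_⟩
      subst h1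
      rw [ex, ey, nsmul_eq_mul]
      field_simp
      push_cast
      ring
    by_cases h2 : l = 1
    · right
      refine ⟨k, hk, s + k • r, add_mem hs (AddSubmonoid.nsmul_mem _ hr _), ?_⟩
      subst h2
      rw [ex, ey, nsmul_eq_mul]
      field_simp
      push_cast
      ring
    left
    have hk2 : (2 : ℝ) ≤ k := by exact_mod_cast (by omega : 2 ≤ k)
    have hl2 : (2 : ℝ) ≤ l := by exact_mod_cast (by omega : 2 ≤ l)
    have a1 : 1 / 2 ≤ x := by rw [ex, le_div_iff₀ hk']; linarith
    have a2 : 1 / 2 ≤ y := by rw [ey, le_div_iff₀ hl']; linarith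
    linarith

/-- **Lemma 2.16.** For any `Λ ⊆ [0,1]` we have `D(D(Λ)) = D(Λ)`, i.e. the
derived set `D(Λ)` is itself a derived set. -/
theorem derivedCoeffSet_derivedCoeffSet (Λ : Set ℝ) (hΛ : Λ ⊆ Set.Icc 0 1) :
    derivedCoeffSet (derivedCoeffSet Λ) = derivedCoeffSet Λ := by
  ext a
  constructor
  · intro h
    obtain ⟨ha, m, hm, t, ht, e⟩ := (derivedCoeffSet_mem_iff _ a).1 h
    have hm' : (0 : ℝ) < m := by exact_mod_cast hm
    rw [derivedCoeffSet_mem_iff]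
    refine ⟨ha, ?_⟩
    rcases (derivedCoeffSet_closure Λ hΛ t ht).2 with h1 | ⟨k, hk, s, hs, et⟩
    · refine ⟨1, one_pos, 1, AddSubmonoid.subset_closure (by simp), ?_⟩
      have : 1 ≤ a := by rw [e, le_div_iff₀ hm']; linarith
      have := ha.2
      norm_num
      linarith
    · have hk' : (0 : ℝ) < k := by exact_mod_cast hk
      refine ⟨m * k, Nat.mul_pos hm hk, s, hs, ?_⟩
      rw [e, et]
      push_cast
      field_simp
      ring
  · intro h
    rw [derivedCoeffSet_mem_iff]
    exact ⟨h.1, 1, one_pos, a, AddSubmonoid.subset_closure (Or.inl h), by norm_num⟩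
end

section
/- The set 𝒮 := {1 − 1/m : m a positive integer} ∪ {1} of standard coefficients is derived; that is, D(𝒮) = 𝒮. -/
/-- The set `𝒮 = {1 - 1/m ∣ m ∈ ℤ_{>0}} ∪ {1}` of standard coefficients. -/
def standardCoefficients : Set ℝ :=
  {x | ∃ m : ℕ, 0 < m ∧ x = 1 - 1 / (m : ℝ)} ∪ {1}

lemma std_cases {x : ℝ} (hx : x ∈ standardCoefficients) : x = 0 ∨ (1/2 ≤ x ∧ x ≤ 1) := by
  rcases hx with ⟨m, hm, rfl⟩ | hx
  · rcases Nat.lt_or_ge m 2 with h | h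
    · left
      have : m = 1 := by omega
      subst this
      norm_num
    · right
      have h2 : (2 : ℝ) ≤ m := by exact_mod_cast h
      have h3 : 1 / (m : ℝ) ≤ 1 / 2 := one_div_le_one_div_of_le (by norm_num) h2
      have h4 : 0 ≤ 1 / (m : ℝ) := by positivity
      constructor <;> linarith
  · right
    have : x = 1 := hx
    subst this
    norm_num

lemma std_zero : (0 : ℝ) ∈ standardCoefficients := Or.inl ⟨1, one_pos, by norm_num⟩

lemma std_one : (1 : ℝ) ∈ standardCoefficients := Or.inr rfl

lemma std_nonneg {x : ℝ} (hx : x ∈ standardCoefficients) : 0 ≤ x := by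
  rcases std_cases hx with h | h <;> linarith

lemma std_add {x y : ℝ} (hx : x ∈ standardCoefficients) (hy : y ∈ standardCoefficients)
    (h : x + y ≤ 1) : x + y ∈ standardCoefficients := by
  rcases std_cases hx with h1 | h1
  · rw [h1, zero_add]; exact hy
  rcases std_cases hy with h2 | h2
  · rw [h2, add_zero]; exact hx
  have : x + y = 1 := by linarith
  rw [this]; exact std_one

lemma std_sum {ι : Type} (t : Finset ι) (f : ι → ℝ) (hf : ∀ i, f i ∈ standardCoefficients)
    (h : ∑ i ∈ t, f i ≤ 1) : ∑ i ∈ t, f i ∈ standardCoefficients := by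
  classical
  induction t using Finset.induction_on with
  | empty => simpa using std_zero
  | insert a s ha ih =>
    rw [Finset.sum_insert ha] at h ⊢
    exact std_add (hf a) (ih (by linarith [std_nonneg (hf a)])) h

/-- The set of standard coefficients is derived: `D(𝒮) = 𝒮`. -/
theorem derivedCoeffSet_standardCoefficients :
    derivedCoeffSet standardCoefficients = standardCoefficients := by
  ext a
  constructor
  · rintro ⟨⟨_, h1⟩, n, m, hm, f, hf, rfl⟩
    have hm' : (0 : ℝ) < m := by exact_mod_cast hm
    have hf' : ∀ i, f i ∈ standardCoefficients := by
      intro i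
      rcases hf i with h | h | h
      · exact h
      · rw [h]; exact std_zero
      · rw [show f i = 1 from h]; exact std_one
    rw [div_le_one hm'] at h1
    have hs := std_sum Finset.univ f hf' (by linarith)
    rcases hs with ⟨k, hk, hs⟩ | hs
    · left
      refine ⟨m * k, Nat.mul_pos hm hk, ?_⟩
      have hk' : (0 : ℝ) < k := by exact_mod_cast hk
      rw [hs]
      push_cast
      field_simp
      ring
    · right
      rw [show ∑ i, f i = 1 from hs]
      show _ = _
      field_simp
      ring
  · intro h
    refine ⟨⟨std_nonneg h, ?_⟩, 1, 1, one_pos, fun _ => a, fun _ => Or.inl h, by simp⟩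
    rcases std_cases h with h | h <;> linarith
end

section
/- Let t be a real number with 5/6 < t ≤ 1. Let n be a positive integer and suppose that for each i ∈ {1, …, n} we are given a positive integer mᵢ and nonnegative integers sᵢ, rᵢ; set cᵢ := (mᵢ − 1 + sᵢ·t + rᵢ)/mᵢ. Assume that cᵢ ≤ 1 for every i, that s₁ ≥ 1, and that there exists a real number d with 2d a nonnegative integer such that c₁ + ⋯ + cₙ + d = 2. Then t = 1. -/
/-- The set `{0, 1/2} ∪ [2/3, 1] ∪ [7/6, ∞)`, which is closed under addition. -/
def GapSet (x : ℝ) : Prop := x = 0 ∨ x = 1 / 2 ∨ (2 / 3 ≤ x ∧ x ≤ 1) ∨ 7 / 6 ≤ x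

theorem GapSet.add {x y : ℝ} (hx : GapSet x) (hy : GapSet y) : GapSet (x + y) := by
  unfold GapSet at *
  rcases hx with rfl | rfl | ⟨h1, h2⟩ | h1 <;> rcases hy with rfl | rfl | ⟨h3, h4⟩ | h3
  · left; norm_num
  · right; left; norm_num
  · right; right; left; constructor <;> linarith
  · right; right; right; linarith
  · right; left; norm_num
  · right; right; left; norm_num
  all_goals first
    | (right; right; right; linarith)
    | (right; right; left; constructor <;> linarith)

theorem GapSet.half (k : ℕ) : GapSet ((k : ℝ) / 2) := by
  induction k with
  | zero => left; simp
  | succ k ih =>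
    have h : GapSet (1 / 2 : ℝ) := Or.inr (Or.inl rfl)
    have := ih.add h
    convert this using 1
    push_cast; ring

theorem GapSet.sum {ι : Type*} (S : Finset ι) (f : ι → ℝ) (h : ∀ i ∈ S, GapSet (f i)) :
    GapSet (∑ i ∈ S, f i) :=
  Finset.sum_induction f GapSet (fun _ _ => GapSet.add) (Or.inl rfl) h

theorem GapSet.coeff {t : ℝ} (ht : 5 / 6 < t) (m s r : ℕ) (hm : 0 < m)
    (hle : ((m : ℝ) - 1 + (s : ℝ) * t + (r : ℝ)) / (m : ℝ) ≤ 1) :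
    GapSet (((m : ℝ) - 1 + (s : ℝ) * t + (r : ℝ)) / (m : ℝ)) := by
  have hmR : (0 : ℝ) < m := by exact_mod_cast hm
  have hr0 : (0 : ℝ) ≤ r := Nat.cast_nonneg r
  have hst : (0 : ℝ) ≤ (s : ℝ) * t := mul_nonneg (Nat.cast_nonneg s) (by linarith)
  by_cases h0 : s = 0 ∧ r = 0
  · obtain ⟨rfl, rfl⟩ := h0
    by_cases h1 : m = 1
    · subst h1; left; norm_num
    by_cases h2 : m = 2
    · subst h2; right; left; norm_num
    have h3 : (3 : ℝ) ≤ m := by exact_mod_cast (by omega : 3 ≤ m)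
    right; right; left
    refine ⟨?_, hle⟩
    rw [le_div_iff₀ hmR]
    linarith
  · have h1 : (1 : ℝ) ≤ m := by exact_mod_cast hm
    have hbig : 5 / 6 ≤ (s : ℝ) * t + r := by
      by_cases hs : s = 0
      · have : (1 : ℝ) ≤ r := by exact_mod_cast (by omega : 1 ≤ r)
        linarith
      · have : (1 : ℝ) ≤ s := by exact_mod_cast (by omega : 1 ≤ s)
        nlinarith
    right; right; left
    refine ⟨?_, hle⟩
    rw [le_div_iff₀ hmR]
    linarith

/-- **Arithmetic content of Lemma 7.5.**
Let `5/6 < t ≤ 1` be real.  Suppose we have coefficients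
`cᵢ = (mᵢ - 1 + sᵢ·t + rᵢ)/mᵢ ≤ 1` with `mᵢ ∈ ℤ_{>0}`, `sᵢ, rᵢ ∈ ℤ_{≥0}`,
`s₁ ≥ 1`, and a real `d` with `2d ∈ ℤ_{≥0}` such that
`c₁ + ⋯ + cₙ + d = 2`.  Then `t = 1`. -/
theorem lct_coreg_one_eq_one (t : ℝ) (ht₁ : 5 / 6 < t) (ht₂ : t ≤ 1)
    (n : ℕ) (hn : 0 < n) (m s r : Fin n → ℕ) (hm : ∀ i, 0 < m i)
    (c : Fin n → ℝ)
    (hc : ∀ i, c i = ((m i : ℝ) - 1 + (s i : ℝ) * t + (r i : ℝ)) / (m i : ℝ))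
    (hle : ∀ i, c i ≤ 1) (hs : 1 ≤ s ⟨0, hn⟩)
    (d : ℝ) (hd : ∃ k : ℕ, 2 * d = (k : ℝ))
    (hsum : (∑ i, c i) + d = 2) :
    t = 1 := by
  obtain ⟨k, hk⟩ := hd
  by_contra hne
  have hlt : t < 1 := lt_of_le_of_ne ht₂ hne
  have hP : GapSet ((∑ i ∈ Finset.univ.erase (⟨0, hn⟩ : Fin n), c i) + (k : ℝ) / 2) := by
    refine (GapSet.sum _ _ fun i _ => ?_).add (GapSet.half k)
    have h := hle i
    rw [hc i] at h ⊢
    exact GapSet.coeff ht₁ _ _ _ (hm i) h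
  have hsplit := Finset.add_sum_erase Finset.univ c (Finset.mem_univ (⟨0, hn⟩ : Fin n))
  have h0 := hle ⟨0, hn⟩
  have hc0 := hc ⟨0, hn⟩
  have hm0 : (1 : ℝ) ≤ m ⟨0, hn⟩ := by exact_mod_cast hm ⟨0, hn⟩
  have hmpos : (0 : ℝ) < m ⟨0, hn⟩ := by linarith
  have hsR : (1 : ℝ) ≤ s ⟨0, hn⟩ := by exact_mod_cast hs
  have hr0 : (0 : ℝ) ≤ r ⟨0, hn⟩ := Nat.cast_nonneg _
  have hle0 : (s ⟨0, hn⟩ : ℝ) * t + r ⟨0, hn⟩ ≤ 1 := by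
    rw [hc0, div_le_one hmpos] at h0
    linarith
  have hs1 : s ⟨0, hn⟩ = 1 := by
    by_contra h
    have : (2 : ℝ) ≤ s ⟨0, hn⟩ := by exact_mod_cast (by omega : 2 ≤ s ⟨0, hn⟩)
    nlinarith
  have hr1 : r ⟨0, hn⟩ = 0 := by
    by_contra h
    have : (1 : ℝ) ≤ r ⟨0, hn⟩ := by exact_mod_cast (by omega : 1 ≤ r ⟨0, hn⟩)
    nlinarith
  rw [hs1, hr1] at hc0
  have hlow : 5 / 6 < c ⟨0, hn⟩ := by
    rw [hc0, lt_div_iff₀ hmpos]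
    push_cast
    linarith
  have hup : c ⟨0, hn⟩ < 1 := by
    rw [hc0, div_lt_one hmpos]
    push_cast
    linarith
  rcases hP with h | h | ⟨_, h⟩ | h <;> linarith
end
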